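/- Fix an integer k ≥ 2, an integer j with 0 ≤ j ≤ k, and constants C_F, c₁, c₂ > 0. There exists C > 0, depending only on k, j, C_F, c₁, c₂, such that for every h ∈ (0,1], every map F : ℝ² → ℝ² with polynomial components of total degree ≤ k satisfying the isoparametric bounds of order k (with constants C_F, c₁, c₂ and parameter h), every v̂ : ℝ² → ℝ² with polynomial components of total degree ≤ k, and every i ∈ {1,2,3}, the Piola transform v of v̂ under F satisfies |v̂|_{H^j(K̂ᵢ)} ≤ C h^j ‖v‖_{H^j(F(K̂ᵢ))}. -/

import Mathlib

open Set MeasureTheory Function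

noncomputable section

/-- The open reference triangle with vertices (0,0), (1,0), (0,1). -/
def Tref : Set (ℝ × ℝ) := {x | 0 < x.1 ∧ 0 < x.2 ∧ x.1 + x.2 < 1}

/-- The three vertices of the reference triangle. -/
def vtx : Fin 3 → ℝ × ℝ := ![(0, 0), (1, 0), (0, 1)]

/-- The (open) Clough–Tocher subtriangles, obtained by connecting the barycenter
to the vertices. -/
def ctK (i : Fin 3) : Set (ℝ × ℝ) :=
  interior (convexHull ℝ {vtx i, vtx (i + 1), ((1 : ℝ) / 3, (1 : ℝ) / 3)})

/-- A map `ℝ² → ℝ²` whose two components are polynomials of total degree ≤ k. -/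
def IsPolyMap (k : ℕ) (F : ℝ × ℝ → ℝ × ℝ) : Prop :=
  ∃ P Q : MvPolynomial (Fin 2) ℝ, P.totalDegree ≤ k ∧ Q.totalDegree ≤ k ∧
    ∀ x : ℝ × ℝ,
      F x = (MvPolynomial.eval ![x.1, x.2] P, MvPolynomial.eval ![x.1, x.2] Q)

/-- The Jacobian determinant of `F`. -/
def jacDet (F : ℝ × ℝ → ℝ × ℝ) (x : ℝ × ℝ) : ℝ :=
  LinearMap.det ((fderiv ℝ F x) : (ℝ × ℝ) →ₗ[ℝ] (ℝ × ℝ))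

/-- The Piola matrix `A(x) = DF(x) / det DF(x)`. -/
def Amap (F : ℝ × ℝ → ℝ × ℝ) (x : ℝ × ℝ) : (ℝ × ℝ) →L[ℝ] (ℝ × ℝ) :=
  (jacDet F x)⁻¹ • fderiv ℝ F x

/-- `B(x) = det DF(x) · (DF(x))⁻¹`, the adjugate of `DF`. -/
def Bmap (F : ℝ × ℝ → ℝ × ℝ) (x : ℝ × ℝ) : (ℝ × ℝ) →L[ℝ] (ℝ × ℝ) :=
  jacDet F x • Ring.inverse (fderiv ℝ F x)

/-- `v` is the Piola transform of `v̂` under `F`. -/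
def IsPiola (F vh v : ℝ × ℝ → ℝ × ℝ) : Prop :=
  ∀ x ∈ closure Tref, v (F x) = Amap F x (vh x)

/-- The `W^{m,p}` seminorm over a set `S` (for `p < ∞`). -/
def semiLp {E : Type*} [NormedAddCommGroup E] [NormedSpace ℝ E]
    (m : ℕ) (p : ℝ) (w : ℝ × ℝ → E) (S : Set (ℝ × ℝ)) : ℝ :=
  (∫ x in S, ‖iteratedFDeriv ℝ m w x‖ ^ p) ^ (1 / p)

/-- The `W^{m,p}` norm over a set `S`: the sum of the seminorms up to order `m`. -/
def normWmp {E : Type*} [NormedAddCommGroup E] [NormedSpace ℝ E]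
    (m : ℕ) (p : ℝ) (w : ℝ × ℝ → E) (S : Set (ℝ × ℝ)) : ℝ :=
  ∑ j ∈ Finset.range (m + 1), semiLp j p w S

/-- The isoparametric bounds of order `k` with constants `CF, c₁, c₂` and parameter `h`. -/
def IsoparamBounds (k : ℕ) (CF c₁ c₂ h : ℝ) (F : ℝ × ℝ → ℝ × ℝ) : Prop :=
  InjOn F (closure Tref) ∧
  (∀ m : ℕ, m ≤ k → ∀ x ∈ Tref, ‖iteratedFDeriv ℝ m F x‖ ≤ CF * h ^ m) ∧
  (∀ m : ℕ, m ≤ k + 1 → ∀ y ∈ F '' Tref,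
    ‖iteratedFDeriv ℝ m (invFunOn F (closure Tref)) y‖ ≤ CF * h ^ (-(m : ℤ))) ∧
  (∀ x ∈ closure Tref, c₁ * h ^ 2 ≤ jacDet F x ∧ jacDet F x ≤ c₂ * h ^ 2)

/-- The (planar) divergence of a vector field. -/
def pdiv (w : ℝ × ℝ → ℝ × ℝ) (x : ℝ × ℝ) : ℝ :=
  (fderiv ℝ w x (1, 0)).1 + (fderiv ℝ w x (0, 1)).2


open scoped ContDiff

def QZ {G : Type*} [NormedAddCommGroup G] [NormedSpace ℝ G] (n : ℕ) (f : ℝ × ℝ → G) : Prop :=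
  ContDiff ℝ ∞ f ∧ ∀ m, n < m → ∀ x, iteratedFDeriv ℝ m f x = 0

section QZ
variable {G : Type*} [NormedAddCommGroup G] [NormedSpace ℝ G]

lemma natle (m : ℕ) : (m : WithTop ℕ∞) ≤ ∞ := by exact_mod_cast le_top

lemma QZ.mono {n n' : ℕ} {f : ℝ × ℝ → G} (h : QZ n f) (hn : n ≤ n') : QZ n' f :=
  ⟨h.1, fun m hm => h.2 m (by omega)⟩

lemma QZ.const (c : G) : QZ 0 (fun _ : ℝ × ℝ => c) :=
  ⟨contDiff_const, fun m hm x => by rw [iteratedFDeriv_const_of_ne (by omega)]; rfl⟩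

lemma QZ.clm (L : ℝ × ℝ →L[ℝ] G) : QZ 1 (fun x => L x) := by
  refine ⟨L.contDiff, fun m hm x => ?_⟩
  obtain ⟨m, rfl⟩ : ∃ r, m = r + 1 := ⟨m - 1, by omega⟩
  rw [← norm_eq_zero, ← norm_iteratedFDeriv_fderiv]
  have : fderiv ℝ (fun x => L x) = fun _ => L := by
    ext1 x; exact L.fderiv
  rw [this, iteratedFDeriv_const_of_ne (by omega)]
  simp

lemma QZ.add {n : ℕ} {f g : ℝ × ℝ → G} (hf : QZ n f) (hg : QZ n g) :
    QZ n (fun x => f x + g x) := by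
  refine ⟨hf.1.add hg.1, fun m hm x => ?_⟩
  have := iteratedFDeriv_add_apply (𝕜 := ℝ) (i := m) (x := x)
    ((hf.1.of_le (natle m)).contDiffAt) ((hg.1.of_le (natle m)).contDiffAt)
  rw [hf.2 m hm, hg.2 m hm, add_zero] at this
  exact this

lemma QZ.mul {a b : ℕ} {f g : ℝ × ℝ → ℝ} (hf : QZ a f) (hg : QZ b g) :
    QZ (a + b) (fun x => f x * g x) := by
  refine ⟨hf.1.mul hg.1, fun m hm x => ?_⟩
  rw [← norm_le_zero_iff]
  refine (norm_iteratedFDeriv_mul_le hf.1 hg.1 x (natle m)).trans ?_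
  apply le_of_eq
  apply Finset.sum_eq_zero
  intro i hi
  rcases lt_or_ge a i with h | h
  · simp [hf.2 i h]
  · rw [hg.2 (m - i) (by omega)]; simp

lemma QZ.pow {a : ℕ} {f : ℝ × ℝ → ℝ} (hf : QZ a f) (r : ℕ) :
    QZ (r * a) (fun x => f x ^ r) := by
  induction r with
  | zero => simpa using QZ.const (1 : ℝ)
  | succ r ih =>
    have := ih.mul hf
    simp only [pow_succ]
    exact this.mono (by ring_nf; rfl)

lemma QZ.sum {ι : Type*} (s : Finset ι) {n : ℕ} {f : ι → ℝ × ℝ → G} (h : ∀ i ∈ s, QZ n (f i)) :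
    QZ n (fun x => ∑ i ∈ s, f i x) := by
  classical
  induction s using Finset.induction_on with
  | empty => simpa using (QZ.const (0 : G)).mono (Nat.zero_le n)
  | insert a s ha ih =>
    simp only [Finset.sum_insert ha]
    exact (h a (by simp)).add (ih fun i hi => h i (by simp [hi]))

lemma QZ.comp_left {G' : Type*} [NormedAddCommGroup G'] [NormedSpace ℝ G'] (L : G →L[ℝ] G')
    {n : ℕ} {f : ℝ × ℝ → G} (hf : QZ n f) : QZ n (fun x => L (f x)) := by
  refine ⟨L.contDiff.comp hf.1, fun m hm x => ?_⟩
  rw [← norm_le_zero_iff]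
  have := L.norm_iteratedFDeriv_comp_left (n := m) hf.1.contDiffAt (x := x) (natle m)
  rw [hf.2 m hm] at this
  simpa [Function.comp_def] using this
end QZ

lemma QZ.poly {k : ℕ} (P : MvPolynomial (Fin 2) ℝ) (hP : P.totalDegree ≤ k) :
    QZ k (fun x : ℝ × ℝ => MvPolynomial.eval ![x.1, x.2] P) := by
  have e : (fun x : ℝ × ℝ => MvPolynomial.eval ![x.1, x.2] P) = fun x : ℝ × ℝ =>
      ∑ d ∈ P.support, MvPolynomial.coeff d P * (x.1 ^ d 0 * x.2 ^ d 1) := by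
    ext1 x
    rw [MvPolynomial.eval_eq']
    simp [Fin.prod_univ_two]
  rw [e]
  apply QZ.sum
  intro d hd
  have h1 : d 0 + d 1 ≤ k := by
    have := MvPolynomial.le_totalDegree hd
    rw [Finsupp.sum_fintype _ _ (by simp)] at this
    simp at this
    omega
  have hx := (QZ.clm (ContinuousLinearMap.fst ℝ ℝ ℝ)).pow (d 0)
  have hy := (QZ.clm (ContinuousLinearMap.snd ℝ ℝ ℝ)).pow (d 1)
  exact ((QZ.const (MvPolynomial.coeff d P)).mul (hx.mul hy)).mono (by omega)

lemma QZ.polyMap {k : ℕ} {F : ℝ × ℝ → ℝ × ℝ} (hF : IsPolyMap k F) : QZ k F := by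
  obtain ⟨P, Q, hP, hQ, h⟩ := hF
  have : F = fun x => ContinuousLinearMap.inl ℝ ℝ ℝ (MvPolynomial.eval ![x.1, x.2] P)
      + ContinuousLinearMap.inr ℝ ℝ ℝ (MvPolynomial.eval ![x.1, x.2] Q) := by
    ext1 x; rw [h]; simp
  rw [this]
  exact ((QZ.poly P hP).comp_left _).add ((QZ.poly Q hQ).comp_left _)

/-! Adjugate -/

def trL : ((ℝ × ℝ) →L[ℝ] (ℝ × ℝ)) →L[ℝ] ℝ :=
  (ContinuousLinearMap.fst ℝ ℝ ℝ).comp (ContinuousLinearMap.apply ℝ (ℝ × ℝ) ((1, 0) : ℝ × ℝ)) +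
  (ContinuousLinearMap.snd ℝ ℝ ℝ).comp (ContinuousLinearMap.apply ℝ (ℝ × ℝ) ((0, 1) : ℝ × ℝ))

def adjL : ((ℝ × ℝ) →L[ℝ] (ℝ × ℝ)) →L[ℝ] ((ℝ × ℝ) →L[ℝ] (ℝ × ℝ)) :=
  trL.smulRight (ContinuousLinearMap.id ℝ (ℝ × ℝ)) - ContinuousLinearMap.id ℝ _

lemma det_two (M : (ℝ × ℝ) →L[ℝ] (ℝ × ℝ)) :
    LinearMap.det (M : (ℝ × ℝ) →ₗ[ℝ] (ℝ × ℝ)) =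
      (M (1, 0)).1 * (M (0, 1)).2 - (M (0, 1)).1 * (M (1, 0)).2 := by
  rw [← LinearMap.det_toMatrix (Module.Basis.finTwoProd ℝ), Matrix.det_fin_two]
  simp [LinearMap.toMatrix_apply]

lemma adj_mul (M : (ℝ × ℝ) →L[ℝ] (ℝ × ℝ)) (u : ℝ × ℝ) :
    adjL M (M u) = LinearMap.det (M : (ℝ × ℝ) →ₗ[ℝ] (ℝ × ℝ)) • u := by
  have key : ∀ w : ℝ × ℝ, M w = w.1 • M (1, 0) + w.2 • M (0, 1) := by
    intro w
    rw [← map_smul, ← map_smul, ← map_add]; simp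
  rw [det_two]
  have e : adjL M (M u) = ((M (1, 0)).1 + (M (0, 1)).2) • M u - M (M u) := by
    simp [adjL, trL]
  rw [e, key (M u), key u]
  ext <;> simp <;> ring

/-! Geometry -/

lemma isOpen_Tref : IsOpen Tref := by
  have : Tref = {x : ℝ × ℝ | 0 < x.1} ∩ ({x | 0 < x.2} ∩ {x | x.1 + x.2 < 1}) := by
    ext x; rfl
  rw [this]
  exact (isOpen_lt continuous_const continuous_fst).inter
    ((isOpen_lt continuous_const continuous_snd).inter
      (isOpen_lt (continuous_fst.add continuous_snd) continuous_const))

lemma isCompact_closure_Tref : IsCompact (closure Tref) := by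
  apply Bornology.IsBounded.isCompact_closure
  apply (Metric.isBounded_Icc (0 : ℝ × ℝ) 1).subset
  rintro ⟨x, y⟩ ⟨h1, h2, h3⟩
  simp only at h1 h2 h3
  constructor <;> constructor <;> simp <;> linarith

lemma ctK_subset (i : Fin 3) : ctK i ⊆ Tref := by
  set b : ℝ × ℝ := (1/3, 1/3) with hb
  have h1 : convexHull ℝ {vtx i, vtx (i + 1), ((1 : ℝ) / 3, (1 : ℝ) / 3)} ⊆
      {x : ℝ × ℝ | 0 ≤ x.1} ∩ {x | 0 ≤ x.2} ∩ {x | x.1 + x.2 ≤ 1} := by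
    apply convexHull_min
    · rintro x (rfl | rfl | rfl)
      · fin_cases i <;> simp [vtx]
      · fin_cases i <;> simp [vtx]
      · norm_num
    · exact ((convex_halfSpace_ge (LinearMap.fst ℝ ℝ ℝ).isLinear 0).inter
        (convex_halfSpace_ge (LinearMap.snd ℝ ℝ ℝ).isLinear 0)).inter
        (convex_halfSpace_le (LinearMap.fst ℝ ℝ ℝ + LinearMap.snd ℝ ℝ ℝ).isLinear 1)
  intro x hx
  have hx' := mem_interior_iff_mem_nhds.1 hx
  rw [Metric.mem_nhds_iff] at hx'
  obtain ⟨ε, hε, hball⟩ := hx'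
  have hm : ∀ d : ℝ × ℝ, ‖d‖ < ε → x + d ∈ 
      {x : ℝ × ℝ | 0 ≤ x.1} ∩ {x | 0 ≤ x.2} ∩ {x | x.1 + x.2 ≤ 1} := fun d hd =>
    h1 (hball (by simpa using hd))
  have hA : |ε / 2| < ε := by rw [abs_of_pos (by linarith)]; linarith
  have a1 := hm (-(ε/2), -(ε/2)) (by simp [Prod.norm_def]; rwa [abs_div, abs_two] at hA)
  have a2 := hm ((ε/2), (ε/2)) (by simp [Prod.norm_def]; rwa [abs_div, abs_two] at hA)
  simp at a1 a2
  refine ⟨?_, ?_, ?_⟩ <;> linarith [a1.1.1, a1.1.2, a2.2]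

lemma isOpen_ctK (i : Fin 3) : IsOpen (ctK i) := isOpen_interior

/-! Local structure -/

lemma local_rep {F : ℝ × ℝ → ℝ × ℝ} (hF : ContDiff ℝ ∞ F) {u v : ℝ × ℝ → ℝ × ℝ}
    (hv : ∀ x ∈ Tref, v (F x) = u x) {x₀ : ℝ × ℝ} (hd : jacDet F x₀ ≠ 0)
    (hu : ContDiffAt ℝ ∞ u x₀) :
    ∃ w : ℝ × ℝ → ℝ × ℝ, ContDiffAt ℝ ∞ w (F x₀) ∧
      ∀ᶠ x in nhds x₀, x ∈ Tref → v =ᶠ[nhds (F x)] w := by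
  set f' := (fderiv ℝ F x₀).toContinuousLinearEquivOfDetNeZero hd with hf'
  have hfd : HasFDerivAt F (f' : (ℝ × ℝ) →L[ℝ] (ℝ × ℝ)) x₀ := by
    have e1 : (f' : (ℝ × ℝ) →L[ℝ] (ℝ × ℝ)) = fderiv ℝ F x₀ := by
      ext1 <;> rfl
    rw [e1]
    exact (hF.differentiable (by simp) x₀).hasFDerivAt
  have h0 : (∞ : WithTop ℕ∞) ≠ 0 := by simp
  have hFa : ContDiffAt ℝ ∞ F x₀ := hF.contDiffAt
  set e := hFa.toOpenPartialHomeomorph F hfd h0 with he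
  have hec : (e : ℝ × ℝ → ℝ × ℝ) = F := rfl
  have hxs : x₀ ∈ e.source := hFa.mem_toOpenPartialHomeomorph_source hfd h0
  have hsm : ContDiffAt ℝ ∞ e.symm (F x₀) := hFa.to_localInverse hfd h0
  have hes : e.symm (F x₀) = x₀ := e.left_inv hxs
  refine ⟨fun y => u (e.symm y), ?_, ?_⟩
  · apply ContDiffAt.comp (F x₀) _ hsm
    rwa [hes]
  · filter_upwards [e.open_source.mem_nhds hxs] with x hx hxT
    have hFx : F x ∈ e.target := e.map_source hx
    have hc : ContinuousAt e.symm (F x) := e.continuousAt_symm hFx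
    have hl : e.symm (F x) = x := e.left_inv hx
    have hn : Tref ∈ nhds (e.symm (F x)) := by rw [hl]; exact isOpen_Tref.mem_nhds hxT
    filter_upwards [hc.preimage_mem_nhds hn, e.open_target.mem_nhds hFx] with y hy hyt
    have : F (e.symm y) = y := e.right_inv hyt
    rw [← hv _ hy, this]

lemma contDiff_jacDet {F : ℝ × ℝ → ℝ × ℝ} (hF : ContDiff ℝ ∞ F) : ContDiff ℝ ∞ (jacDet F) := by
  have h1 : ContDiff ℝ ∞ (fderiv ℝ F) := hF.fderiv_right (by simp)
  have e : jacDet F = fun x => (fderiv ℝ F x (1, 0)).1 * (fderiv ℝ F x (0, 1)).2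
      - (fderiv ℝ F x (0, 1)).1 * (fderiv ℝ F x (1, 0)).2 := by
    ext1 x; exact det_two _
  rw [e]
  have ha : ContDiff ℝ ∞ (fun x => fderiv ℝ F x (1, 0)) := h1.clm_apply contDiff_const
  have hb : ContDiff ℝ ∞ (fun x => fderiv ℝ F x (0, 1)) := h1.clm_apply contDiff_const
  exact (ha.fst.mul hb.snd).sub (hb.fst.mul ha.snd)

lemma contDiffAt_Amap {F g : ℝ × ℝ → ℝ × ℝ} (hF : ContDiff ℝ ∞ F) (hg : ContDiff ℝ ∞ g)
    {x : ℝ × ℝ} (hd : jacDet F x ≠ 0) : ContDiffAt ℝ ∞ (fun x => Amap F x (g x)) x := by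
  have h1 : ContDiff ℝ ∞ (fderiv ℝ F) := hF.fderiv_right (by simp)
  have h2 := (contDiff_jacDet hF).contDiffAt.inv (x := x) hd
  exact (h2.smul h1.contDiffAt).clm_apply hg.contDiffAt

section loc
variable {F u v : ℝ × ℝ → ℝ × ℝ}

lemma v_smooth (hF : ContDiff ℝ ∞ F)
    (hv : ∀ x ∈ Tref, v (F x) = u x) {x : ℝ × ℝ} (hx : x ∈ Tref) (hd : jacDet F x ≠ 0)
    (hu : ContDiffAt ℝ ∞ u x) : ContDiffAt ℝ ∞ v (F x) := by
  obtain ⟨w, hw, hev⟩ := local_rep hF hv hd hu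
  exact hw.congr_of_eventuallyEq (hev.self_of_nhds hx)

lemma v_deriv_cont (hF : ContDiff ℝ ∞ F) {x : ℝ × ℝ} (hv : ContDiffAt ℝ ∞ v (F x)) (i : ℕ) :
    ContinuousAt (fun x => iteratedFDeriv ℝ i v (F x)) x := by
  have h : ContDiffAt ℝ 0 (iteratedFDeriv ℝ i v) (F x) :=
    hv.iteratedFDeriv_right (by simpa using natle i)
  exact h.continuousAt.comp (f := F) hF.continuous.continuousAt

lemma v_bdd (hF : ContDiff ℝ ∞ F) (hv : ∀ x ∈ Tref, v (F x) = u x)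
    (hd : ∀ x ∈ closure Tref, jacDet F x ≠ 0)
    (hu : ∀ x ∈ closure Tref, ContDiffAt ℝ ∞ u x) (i : ℕ) :
    ∃ M, ∀ x ∈ Tref, ‖iteratedFDeriv ℝ i v (F x)‖ ≤ M := by
  have key : ∃ M, ∀ x ∈ closure Tref, x ∈ Tref → ‖iteratedFDeriv ℝ i v (F x)‖ ≤ M := by
    refine isCompact_closure_Tref.induction_on
      (p := fun s => ∃ M, ∀ x ∈ s, x ∈ Tref → ‖iteratedFDeriv ℝ i v (F x)‖ ≤ M)
      ⟨0, by simp⟩ ?_ ?_ ?_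
    · rintro s t hst ⟨M, hM⟩
      exact ⟨M, fun x hx => hM x (hst hx)⟩
    · rintro s t ⟨M, hM⟩ ⟨M', hM'⟩
      refine ⟨max M M', fun x hx hT => ?_⟩
      rcases hx with hx | hx
      · exact (hM x hx hT).trans (le_max_left _ _)
      · exact (hM' x hx hT).trans (le_max_right _ _)
    · intro x₀ hx₀
      obtain ⟨w, hw, hev⟩ := local_rep hF hv (hd x₀ hx₀) (hu x₀ hx₀)
      have hc := (v_deriv_cont hF hw i).norm
      have hlt := hc.eventually_lt_const (lt_add_one _)
      refine ⟨_, mem_nhdsWithin_of_mem_nhds (hev.and hlt), ‖iteratedFDeriv ℝ i w (F x₀)‖ + 1, ?_⟩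
      rintro x ⟨hx1, hx2⟩ hT
      rw [((hx1 hT).iteratedFDeriv ℝ i).self_of_nhds]
      exact le_of_lt hx2
  obtain ⟨M, hM⟩ := key
  exact ⟨M, fun x hx => hM x (subset_closure hx) hx⟩

lemma isOpen_image (hF : ContDiff ℝ ∞ F) (hd : ∀ x ∈ Tref, jacDet F x ≠ 0) :
    IsOpen (F '' Tref) := by
  rw [isOpen_iff_mem_nhds]
  rintro _ ⟨x, hx, rfl⟩
  have hs : HasStrictFDerivAt F (fderiv ℝ F x) x :=
    hF.contDiffAt.hasStrictFDerivAt (by simp)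
  rw [← hs.map_nhds_eq_of_surj]
  · exact Filter.image_mem_map (isOpen_Tref.mem_nhds hx)
  · have := LinearMap.range_eq_top.2
      ((fderiv ℝ F x).toContinuousLinearEquivOfDetNeZero (hd x hx)).surjective
    exact this

/-- pointwise bound -/
lemma pointwise {k j : ℕ} (hj : j ≤ k) {CF h : ℝ} (hCF : 0 < CF) (hh : 0 < h)
    (hF : QZ k F) (hd : ∀ x ∈ Tref, jacDet F x ≠ 0)
    (hB : ∀ m : ℕ, m ≤ k → ∀ x ∈ Tref, ‖iteratedFDeriv ℝ m F x‖ ≤ CF * h ^ m)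
    {vh : ℝ × ℝ → ℝ × ℝ} (hv : ∀ x ∈ Tref, v (F x) = Amap F x (vh x))
    (hvs : ∀ x ∈ Tref, ContDiffAt ℝ ∞ v (F x)) {x : ℝ × ℝ} (hx : x ∈ Tref) :
    ‖iteratedFDeriv ℝ j vh x‖ ≤
      (∑ i ∈ Finset.range (j + 1), (j.choose i : ℝ) * (‖adjL‖ * CF) *
        ((j - i).factorial * (max 1 CF) ^ (j - i))) * h ^ (j + 1) *
      ∑ i ∈ Finset.range (j + 1), ‖iteratedFDeriv ℝ i v (F x)‖ := by
  set S := ∑ i ∈ Finset.range (j + 1), ‖iteratedFDeriv ℝ i v (F x)‖ with hS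
  have hS0 : 0 ≤ S := Finset.sum_nonneg fun _ _ => norm_nonneg _
  have hUT := isOpen_Tref.uniqueDiffOn (𝕜 := ℝ)
  have hopen := isOpen_image hF.1 hd
  have hUF := hopen.uniqueDiffOn (𝕜 := ℝ)
  have hvon : ContDiffOn ℝ ∞ v (F '' Tref) := by
    rintro _ ⟨y, hy, rfl⟩
    exact (hvs y hy).contDiffWithinAt
  have hfd : ContDiff ℝ ∞ (fderiv ℝ F) := hF.1.fderiv_right (by simp)
  have hadj : ContDiff ℝ ∞ (adjL ∘ fderiv ℝ F) := adjL.contDiff.comp hfd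
  have hvF : ContDiffOn ℝ ∞ (v ∘ F) Tref :=
    hvon.comp hF.1.contDiffOn (mapsTo_image _ _)
  have heq : vh =ᶠ[nhds x] fun y => (adjL ∘ fderiv ℝ F) y ((v ∘ F) y) := by
    filter_upwards [isOpen_Tref.mem_nhds hx] with y hy
    simp only [Function.comp_apply, hv y hy, Amap, smul_apply, map_smul,
      adj_mul]
    rw [smul_smul, ← jacDet, inv_mul_cancel₀ (hd y hy), one_smul]
  rw [(heq.iteratedFDeriv ℝ j).self_of_nhds, ← iteratedFDerivWithin_of_isOpen j isOpen_Tref hx]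
  refine (norm_iteratedFDerivWithin_clm_apply hadj.contDiffOn hvF hUT hx (natle j)).trans ?_
  rw [Finset.sum_mul, Finset.sum_mul]
  apply Finset.sum_le_sum
  intro i hi
  have hij : i ≤ j := by simp at hi; omega
  have b1 : ‖iteratedFDerivWithin ℝ i (adjL ∘ fderiv ℝ F) Tref x‖ ≤ ‖adjL‖ * (CF * h ^ (i + 1)) := by
    rw [iteratedFDerivWithin_of_isOpen i isOpen_Tref hx]
    refine (adjL.norm_iteratedFDeriv_comp_left hfd.contDiffAt (natle i)).trans ?_
    gcongr
    rw [norm_iteratedFDeriv_fderiv]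
    rcases le_or_gt (i + 1) k with h1 | h1
    · exact hB _ h1 x hx
    · rw [hF.2 _ h1, norm_zero]; positivity
  have b2 : ‖iteratedFDerivWithin ℝ (j - i) (v ∘ F) Tref x‖ ≤
      (j - i).factorial * S * (max 1 CF * h) ^ (j - i) := by
    refine norm_iteratedFDerivWithin_comp_le hvon hF.1.contDiffOn (natle (j - i)) hUF hUT
      (mapsTo_image _ _) hx ?_ ?_
    · intro l hl
      rw [iteratedFDerivWithin_of_isOpen l hopen (mem_image_of_mem _ hx)]
      exact Finset.single_le_sum (f := fun i => ‖iteratedFDeriv ℝ i v (F x)‖)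
        (fun _ _ => norm_nonneg _) (by simp; omega)
    · intro l hl1 hl2
      rw [iteratedFDerivWithin_of_isOpen l isOpen_Tref hx, mul_pow]
      refine (hB l (by omega) x hx).trans ?_
      gcongr
      exact (le_max_right 1 CF).trans (le_self_pow₀ (le_max_left _ _) (by omega))
  calc _ ≤ (j.choose i : ℝ) * (‖adjL‖ * (CF * h ^ (i + 1))) *
        ((j - i).factorial * S * (max 1 CF * h) ^ (j - i)) := by gcongr
    _ = _ := by
      rw [mul_pow, show j + 1 = (i + 1) + (j - i) by omega, pow_add h (i + 1) (j - i)]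
      ring
end loc

lemma integrable_aux {g : ℝ × ℝ → ℝ} {K : Set (ℝ × ℝ)} (hK : IsOpen K) (hKT : K ⊆ Tref)
    (hc : ContinuousOn g K) {M : ℝ} (hM : ∀ x ∈ K, ‖g x‖ ≤ M) : IntegrableOn g K := by
  have hfin : volume K < ⊤ :=
    (measure_mono (hKT.trans subset_closure)).trans_lt isCompact_closure_Tref.measure_lt_top
  haveI : IsFiniteMeasure (volume.restrict K) := ⟨by simpa using hfin⟩
  exact Integrable.of_bound (hc.aestronglyMeasurable hK.measurableSet) M
    ((ae_restrict_iff' hK.measurableSet).2 (Filter.Eventually.of_forall hM))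
/-- Scaling estimate for the Piola transform: `|v̂|_{H^j(K̂ᵢ)} ≤ C h^j ‖v‖_{H^j(F(K̂ᵢ))}`. -/
theorem stmt12 (k j : ℕ) (hk : 2 ≤ k) (hj : j ≤ k)
    (CF c₁ c₂ : ℝ) (hCF : 0 < CF) (hc₁ : 0 < c₁) (hc₂ : 0 < c₂) :
    ∃ C : ℝ, 0 < C ∧ ∀ h : ℝ, h ∈ Set.Ioc (0 : ℝ) 1 → ∀ F : ℝ × ℝ → ℝ × ℝ,
      IsPolyMap k F → IsoparamBounds k CF c₁ c₂ h F →
      ∀ vhat : ℝ × ℝ → ℝ × ℝ, IsPolyMap k vhat →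
      ∀ v : ℝ × ℝ → ℝ × ℝ, IsPiola F vhat v →
      ∀ i : Fin 3,
        semiLp j 2 vhat (ctK i) ≤ C * h ^ j * normWmp j 2 v (F '' ctK i) := by
  set K₀ : ℝ := ∑ i ∈ Finset.range (j + 1), (j.choose i : ℝ) * (‖adjL‖ * CF) *
        ((j - i).factorial * (max 1 CF) ^ (j - i)) with hK₀
  have hK₀0 : 0 ≤ K₀ := Finset.sum_nonneg fun i _ => by positivity
  refine ⟨(K₀ + 1) * Real.sqrt ((j + 1) / c₁), by positivity, ?_⟩
  rintro h ⟨hh, hh1⟩ F hFp ⟨hinj, hB, -, hdet⟩ vh hvp v hpi i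
  have hF := QZ.polyMap hFp
  have hvh := QZ.polyMap hvp
  have hd : ∀ x ∈ closure Tref, jacDet F x ≠ 0 := fun x hx => by
    have h0 : 0 < c₁ * h ^ 2 := by positivity
    exact (h0.trans_le (hdet x hx).1).ne'
  have hdT : ∀ x ∈ Tref, jacDet F x ≠ 0 := fun x hx => hd x (subset_closure hx)
  have hv : ∀ x ∈ Tref, v (F x) = Amap F x (vh x) := fun x hx => hpi x (subset_closure hx)
  have hu : ∀ x ∈ closure Tref, ContDiffAt ℝ ∞ (fun x => Amap F x (vh x)) x :=
    fun x hx => contDiffAt_Amap hF.1 hvh.1 (hd x hx)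
  have hvs : ∀ x ∈ Tref, ContDiffAt ℝ ∞ v (F x) := fun x hx =>
    v_smooth hF.1 hv hx (hdT x hx) (hu x (subset_closure hx))
  set K := ctK i with hK
  have hKo : IsOpen K := isOpen_ctK i
  have hKT : K ⊆ Tref := ctK_subset i
  have hpt := fun x hx => pointwise hj hCF hh hF hdT hB hv hvs (x := x) (hKT hx)
  rw [← hK₀] at hpt
  -- integrability
  have hcN : ∀ l, ContinuousOn (fun x => ‖iteratedFDeriv ℝ l v (F x)‖ ^ 2) K := fun l x hx =>
    ((v_deriv_cont hF.1 (hvs x (hKT hx)) l).norm.pow 2).continuousWithinAt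
  have hiN : ∀ l, IntegrableOn (fun x => ‖iteratedFDeriv ℝ l v (F x)‖ ^ 2) K := by
    intro l
    obtain ⟨M, hM⟩ := v_bdd hF.1 hv hd hu l
    refine integrable_aux hKo hKT (hcN l) (M := M ^ 2) fun x hx => ?_
    rw [norm_pow, norm_norm]
    exact pow_le_pow_left₀ (norm_nonneg _) (hM x (hKT hx)) 2
  have hiD : ∀ l, IntegrableOn (fun x => jacDet F x * ‖iteratedFDeriv ℝ l v (F x)‖ ^ 2) K := by
    intro l
    obtain ⟨M, hM⟩ := v_bdd hF.1 hv hd hu l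
    refine integrable_aux hKo hKT ((contDiff_jacDet hF.1).continuous.continuousOn.mul (hcN l))
      (M := c₂ * h ^ 2 * M ^ 2) fun x hx => ?_
    have hdx := hdet x (subset_closure (hKT hx))
    have h0 : 0 < c₁ * h ^ 2 := by positivity
    rw [norm_mul, norm_pow, norm_norm, Real.norm_of_nonneg (by linarith)]
    have := hM x (hKT hx)
    gcongr
    exact hdx.2
  -- change of variables
  have hcv : ∀ l, c₁ * h ^ 2 * (∫ x in K, ‖iteratedFDeriv ℝ l v (F x)‖ ^ 2) ≤
      ∫ y in F '' K, ‖iteratedFDeriv ℝ l v y‖ ^ 2 := by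
    intro l
    rw [integral_image_eq_integral_abs_det_fderiv_smul volume hKo.measurableSet
      (fun x _ => (hF.1.differentiable (by simp) x).hasFDerivAt.hasFDerivWithinAt)
      (hinj.mono (hKT.trans subset_closure)), ← integral_const_mul]
    have e : ∫ x in K, |(fderiv ℝ F x).det| • ‖iteratedFDeriv ℝ l v (F x)‖ ^ 2 =
        ∫ x in K, jacDet F x * ‖iteratedFDeriv ℝ l v (F x)‖ ^ 2 := by
      refine setIntegral_congr_fun hKo.measurableSet fun x hx => ?_
      have hdx := hdet x (subset_closure (hKT hx))
      have h0 : 0 < c₁ * h ^ 2 := by positivity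
      have e2 : (fderiv ℝ F x).det = jacDet F x := rfl
      simp only [e2, smul_eq_mul]
      rw [abs_of_nonneg (by linarith)]
    rw [e]
    refine setIntegral_mono_on ((hiN l).const_mul _) (hiD l) hKo.measurableSet fun x hx => ?_
    gcongr
    exact (hdet x (subset_closure (hKT hx))).1
  have hsemi : ∀ (l : ℕ) (w : ℝ × ℝ → ℝ × ℝ) (S : Set (ℝ × ℝ)), semiLp l 2 w S =
      Real.sqrt (∫ x in S, ‖iteratedFDeriv ℝ l w x‖ ^ 2) := by
    intro l w S
    simp only [semiLp, Real.rpow_two, Real.sqrt_eq_rpow]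
  -- main estimate
  have hmain : ∫ x in K, ‖iteratedFDeriv ℝ j vh x‖ ^ 2 ≤
      (K₀ * h ^ j) ^ 2 * ((j + 1) / c₁) * ∑ l ∈ Finset.range (j + 1),
        ∫ y in F '' K, ‖iteratedFDeriv ℝ l v y‖ ^ 2 := by
    calc ∫ x in K, ‖iteratedFDeriv ℝ j vh x‖ ^ 2
        ≤ ∫ x in K, (K₀ * h ^ (j + 1)) ^ 2 * ((j + 1) * ∑ l ∈ Finset.range (j + 1),
          ‖iteratedFDeriv ℝ l v (F x)‖ ^ 2) := by
          refine integral_mono_of_nonneg (Filter.Eventually.of_forall fun x => by positivity) ?_ ?_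
          · exact ((integrable_finsetSum _ fun l _ => hiN l).const_mul _).const_mul _
          · refine (ae_restrict_iff' hKo.measurableSet).2 (Filter.Eventually.of_forall ?_)
            intro x hx
            have h1 := pow_le_pow_left₀ (norm_nonneg _) (hpt x hx) 2
            have h2 := sq_sum_le_card_mul_sum_sq (s := Finset.range (j + 1))
              (f := fun l => ‖iteratedFDeriv ℝ l v (F x)‖)
            rw [Finset.card_range, Nat.cast_add, Nat.cast_one] at h2
            refine h1.trans ?_
            rw [mul_pow]
            exact mul_le_mul_of_nonneg_left h2 (by positivity)
      _ = (K₀ * h ^ (j + 1)) ^ 2 * ((j + 1) * ∑ l ∈ Finset.range (j + 1),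
          ∫ x in K, ‖iteratedFDeriv ℝ l v (F x)‖ ^ 2) := by
          rw [integral_const_mul, integral_const_mul, integral_finsetSum _ fun l _ => hiN l]
      _ ≤ (K₀ * h ^ (j + 1)) ^ 2 * ((j + 1) * ∑ l ∈ Finset.range (j + 1),
          (c₁ * h ^ 2)⁻¹ * ∫ y in F '' K, ‖iteratedFDeriv ℝ l v y‖ ^ 2) := by
          gcongr with l hl
          rw [le_inv_mul_iff₀ (by positivity)]
          exact hcv l
      _ = _ := by
          rw [← Finset.mul_sum]
          field_simp
          ring
  have hsum : ∀ (s : Finset ℕ) (a : ℕ → ℝ), (∀ l, 0 ≤ a l) →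
      Real.sqrt (∑ l ∈ s, a l) ≤ ∑ l ∈ s, Real.sqrt (a l) := by
    intro s a ha
    rw [Real.sqrt_le_left (Finset.sum_nonneg fun _ _ => Real.sqrt_nonneg _)]
    calc ∑ l ∈ s, a l = ∑ l ∈ s, Real.sqrt (a l) ^ 2 :=
          Finset.sum_congr rfl fun l _ => (Real.sq_sqrt (ha l)).symm
      _ ≤ _ := Finset.sum_sq_le_sq_sum_of_nonneg fun _ _ => Real.sqrt_nonneg _
  simp only [normWmp, hsemi]
  calc _ ≤ Real.sqrt ((K₀ * h ^ j) ^ 2 * ((j + 1) / c₁) * ∑ l ∈ Finset.range (j + 1),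
        ∫ y in F '' K, ‖iteratedFDeriv ℝ l v y‖ ^ 2) := Real.sqrt_le_sqrt hmain
    _ = K₀ * h ^ j * Real.sqrt ((j + 1) / c₁) * Real.sqrt (∑ l ∈ Finset.range (j + 1),
        ∫ y in F '' K, ‖iteratedFDeriv ℝ l v y‖ ^ 2) := by
        rw [Real.sqrt_mul (by positivity), Real.sqrt_mul (by positivity),
          Real.sqrt_sq (by positivity)]
    _ ≤ K₀ * h ^ j * Real.sqrt ((j + 1) / c₁) * ∑ l ∈ Finset.range (j + 1), Real.sqrt (
        ∫ y in F '' K, ‖iteratedFDeriv ℝ l v y‖ ^ 2) := by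
        gcongr
        exact hsum _ _ fun l => integral_nonneg fun y => by positivity
    _ ≤ (K₀ + 1) * h ^ j * Real.sqrt ((j + 1) / c₁) * ∑ l ∈ Finset.range (j + 1), Real.sqrt (
        ∫ y in F '' K, ‖iteratedFDeriv ℝ l v y‖ ^ 2) := by
        gcongr
        linarith
    _ = _ := by ring
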